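/- For fixed real r ≥ 1 there exists a constant A_r > 0 such that ∑_{k ≤ x} d_r(k)²/k = A_r (log x)^{r²} + O((log x)^{r²−1}) as x → ∞, where d_r is the multiplicative function with d_r(p^k) = Γ(k+r)/(Γ(r)k!). -/

import Mathlib

/-- The generalized divisor function `d_r`: the multiplicative function with
`d_r(p^k) = Γ(k+r)/(Γ(r)·k!)` on prime powers. -/
noncomputable def genDivisor (r : ℝ) (n : ℕ) : ℝ :=
  n.factorization.prod fun _ k => Real.Gamma (k + r) / (Real.Gamma r * Nat.factorial k)

/-- Partial sums in the logarithmic variable. -/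
noncomputable def partN (g : ℕ → ℝ) (u : ℝ) : ℝ := ∑ m ∈ Finset.Icc 1 ⌊Real.exp u⌋₊, g m

/-- The primitive of `partN`. -/
noncomputable def partT (g : ℕ → ℝ) (u : ℝ) : ℝ :=
  ∑ m ∈ Finset.Icc 1 ⌊Real.exp u⌋₊, g m * (u - Real.log m)

lemma mem_floor_exp {u : ℝ} {m : ℕ} :
    m ∈ Finset.Icc 1 ⌊Real.exp u⌋₊ ↔ 1 ≤ m ∧ Real.log m ≤ u := by
  rw [Finset.mem_Icc]
  refine and_congr_right fun hm => ?_
  have : (0:ℝ) < m := by exact_mod_cast hm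
  rw [Nat.le_floor_iff (Real.exp_pos u).le, Real.log_le_iff_le_exp this]

lemma partT_eq_max (g : ℕ → ℝ) {u b : ℝ} (h : u ≤ b) :
    partT g u = ∑ m ∈ Finset.Icc 1 ⌊Real.exp b⌋₊, g m * max (u - Real.log m) 0 := by
  unfold partT
  rw [Finset.sum_congr rfl (g := fun m : ℕ => g m * max (u - Real.log m) 0)]
  · apply Finset.sum_subset
    · intro m hm
      rw [mem_floor_exp] at *
      exact ⟨hm.1, hm.2.trans h⟩
    · intro m hm hm'
      rw [mem_floor_exp] at *
      have : u < Real.log m := by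
        by_contra! hc
        exact hm' ⟨hm.1, hc⟩
      rw [max_eq_right (by linarith), mul_zero]
  · intro m hm
    rw [mem_floor_exp] at hm
    rw [max_eq_left (by linarith [hm.2])]

lemma partT_cont (g : ℕ → ℝ) (a b : ℝ) : ContinuousOn (partT g) (Set.Icc a b) := by
  have : ContinuousOn (fun u => ∑ m ∈ Finset.Icc 1 ⌊Real.exp b⌋₊,
      g m * max (u - Real.log m) 0) (Set.Icc a b) := by fun_prop
  exact this.congr fun u hu => partT_eq_max g hu.2

lemma partT_deriv (g : ℕ → ℝ) (u : ℝ) :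
    HasDerivWithinAt (partT g) (partN g u) (Set.Ici u) u := by
  have h1 : HasDerivWithinAt (fun v => ∑ m ∈ Finset.Icc 1 ⌊Real.exp u⌋₊,
      g m * (v - Real.log m)) (∑ m ∈ Finset.Icc 1 ⌊Real.exp u⌋₊, g m * 1) (Set.Ici u) u := by
    apply HasDerivWithinAt.fun_sum
    intro m _
    exact ((hasDerivWithinAt_id u _).sub_const _).const_mul _
  simp only [mul_one] at h1
  refine h1.congr_of_eventuallyEq ?_ rfl
  have h2 : ∀ᶠ v in nhds u, Real.exp v < ⌊Real.exp u⌋₊ + 1 :=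
    (Real.continuous_exp.tendsto u).eventually_lt_const (Nat.lt_floor_add_one _)
  filter_upwards [nhdsWithin_le_nhds h2, self_mem_nhdsWithin] with v hv hv'
  have : ⌊Real.exp v⌋₊ = ⌊Real.exp u⌋₊ := by
    apply le_antisymm
    · apply Nat.le_of_lt_succ
      rw [Nat.floor_lt (Real.exp_pos v).le]
      exact_mod_cast hv
    · exact Nat.floor_mono (Real.exp_le_exp.2 hv')
  simp only [partT, this]

lemma ratio_deriv (g : ℕ → ℝ) (K c u : ℝ) (h : c < u) :
    HasDerivWithinAt (fun v => partT g v * (v - c) ^ (-K))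
      ((u - c) ^ (-K - 1) * ((u - c) * partN g u - K * partT g u)) (Set.Ici u) u := by
  have h0 : 0 < u - c := by linarith
  have h1 : HasDerivWithinAt (fun v => (v - c) ^ (-K)) (1 * (-K) * (u - c) ^ (-K - 1))
      (Set.Ici u) u :=
    ((hasDerivWithinAt_id u _).sub_const c).rpow_const (Or.inl h0.ne')
  have h2 := (partT_deriv g u).mul h1
  have : (u - c) ^ (-K) = (u - c) ^ (-K - 1) * (u - c) := by
    conv_rhs => rw [← Real.rpow_add_one h0.ne']
    congr 1; ring
  rw [this] at h2
  refine HasDerivWithinAt.congr_deriv h2 ?_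
  ring

lemma ratio_cont (g : ℕ → ℝ) (K c a b : ℝ) (h : c < a) :
    ContinuousOn (fun v => partT g v * (v - c) ^ (-K)) (Set.Icc a b) := by
  apply (partT_cont g a b).mul
  apply ContinuousOn.rpow_const (by fun_prop)
  intro x hx
  left
  have := hx.1
  linarith

lemma ratio_anti (g : ℕ → ℝ) (K c : ℝ)
    (H : ∀ u, c < u → (u - c) * partN g u ≤ K * partT g u) {a b : ℝ} (h : c < a) (hab : a ≤ b) :
    partT g b * (b - c) ^ (-K) ≤ partT g a * (a - c) ^ (-K) := by
  refine image_le_of_deriv_right_le_deriv_boundary (ratio_cont g K c a b h)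
    (fun x hx => ratio_deriv g K c x (h.trans_le hx.1))
    (B := fun _ => partT g a * (a - c) ^ (-K)) (B' := fun _ => 0) le_rfl continuousOn_const
    (fun x _ => hasDerivWithinAt_const _ _ _) ?_ (Set.right_mem_Icc.2 hab)
  intro x hx
  have hx' : c < x := h.trans_le hx.1
  have := H x hx'
  have h3 : 0 ≤ (x - c) ^ (-K - 1) := Real.rpow_nonneg (by linarith) _
  nlinarith

lemma ratio_mono (g : ℕ → ℝ) (K c : ℝ) {a b : ℝ} (h : c < a) (hab : a ≤ b)
    (H : ∀ u, a ≤ u → K * partT g u ≤ (u - c) * partN g u) :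
    partT g a * (a - c) ^ (-K) ≤ partT g b * (b - c) ^ (-K) := by
  refine image_le_of_deriv_right_le_deriv_boundary (a := a) (b := b)
    (B := fun v => partT g v * (v - c) ^ (-K))
    (f := fun _ => partT g a * (a - c) ^ (-K)) (f' := fun _ => 0) continuousOn_const
    (fun x _ => hasDerivWithinAt_const _ _ _) le_rfl (ratio_cont g K c a b h)
    (fun x hx => ratio_deriv g K c x (h.trans_le hx.1)) ?_ (Set.right_mem_Icc.2 hab)
  intro x hx
  have hx' : c < x := h.trans_le hx.1
  have := H x hx.1
  have h3 : 0 ≤ (x - c) ^ (-K - 1) := Real.rpow_nonneg (by linarith) _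
  nlinarith

lemma rpow_upper (κ C u : ℝ) (hκ : 1 ≤ κ) (hC : 1 ≤ C) (hu : 2 * C ≤ u) :
    (u + C) ^ (κ + 1) / (u - C) ≤
      u ^ κ + (κ + 3) * C * Real.exp ((κ + 3)) * u ^ (κ - 1) := by
  have hu0 : 0 < u := by linarith
  set t := C / u with ht
  have ht0 : 0 ≤ t := by positivity
  have ht1 : t ≤ 1 / 2 := by rw [ht, div_le_iff₀ hu0]; linarith
  have e1 : u + C = u * (1 + t) := by rw [ht]; field_simp
  have e2 : u - C = u * (1 - t) := by rw [ht]; field_simp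
  have e3 : (u + C) ^ (κ + 1) = u ^ κ * u * (1 + t) ^ (κ + 1) := by
    rw [e1, Real.mul_rpow hu0.le (by linarith), Real.rpow_add_one hu0.ne']
  have e4 : u ^ (κ - 1) = u ^ κ / u := by rw [Real.rpow_sub_one hu0.ne']
  have b1 : (1 + t) ^ (κ + 1) ≤ Real.exp ((κ + 1) * t) := by
    have : (1 + t) ≤ Real.exp t := by linarith [Real.add_one_le_exp t]
    calc (1 + t) ^ (κ + 1) ≤ (Real.exp t) ^ (κ + 1) :=
          Real.rpow_le_rpow (by linarith) this (by linarith)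
      _ = _ := by rw [← Real.exp_mul]; ring_nf
  have b2 : 1 ≤ Real.exp (2 * t) * (1 - t) := by
    have : 2 * t + 1 ≤ Real.exp (2 * t) := Real.add_one_le_exp _
    nlinarith
  have b3 : Real.exp ((κ + 3) * t) ≤ 1 + (κ + 3) * t * Real.exp (κ + 3) := by
    set y := (κ + 3) * t with hy
    have hy0 : 0 ≤ y := by positivity
    have h1 : -y + 1 ≤ Real.exp (-y) := Real.add_one_le_exp _
    have h2 : Real.exp (-y) * Real.exp y = 1 := by rw [← Real.exp_add]; simp
    have h3 : Real.exp y ≤ Real.exp (κ + 3) := Real.exp_le_exp.2 (by rw [hy]; nlinarith)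
    have h4 := Real.exp_pos y
    nlinarith
  have b4 : (1 + t) ^ (κ + 1) / (1 - t) ≤ 1 + (κ + 3) * t * Real.exp (κ + 3) := by
    refine le_trans ?_ b3
    rw [div_le_iff₀ (by linarith)]
    calc (1 + t) ^ (κ + 1) ≤ Real.exp ((κ + 1) * t) := b1
      _ ≤ Real.exp ((κ + 1) * t) * (Real.exp (2 * t) * (1 - t)) :=
          le_mul_of_one_le_right (Real.exp_pos _).le b2
      _ = _ := by rw [← mul_assoc, ← Real.exp_add]; ring_nf
  have hp : 0 < u ^ κ := Real.rpow_pos_of_pos hu0 _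
  have e5 : (u + C) ^ (κ + 1) / (u - C) = u ^ κ * ((1 + t) ^ (κ + 1) / (1 - t)) := by
    rw [e3, e2]
    have : 1 - t ≠ 0 := by linarith
    field_simp
  rw [e5, e4]
  calc _ ≤ u ^ κ * (1 + (κ + 3) * t * Real.exp (κ + 3)) := by gcongr
    _ = _ := by rw [ht]; ring

lemma rpow_lower (κ C u : ℝ) (hκ : 1 ≤ κ) (hC : 1 ≤ C) (hu : 2 * C ≤ u) :
    u ^ κ - (κ + 2) * C * u ^ (κ - 1) ≤ (u - C) ^ (κ + 1) / (u + C) := by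
  have hu0 : 0 < u := by linarith
  set t := C / u with ht
  have ht0 : 0 ≤ t := by positivity
  have ht1 : t ≤ 1 / 2 := by rw [ht, div_le_iff₀ hu0]; linarith
  have e1 : u + C = u * (1 + t) := by rw [ht]; field_simp
  have e2 : u - C = u * (1 - t) := by rw [ht]; field_simp
  have e3 : (u - C) ^ (κ + 1) = u ^ κ * u * (1 - t) ^ (κ + 1) := by
    rw [e2, Real.mul_rpow hu0.le (by linarith), Real.rpow_add_one hu0.ne']
  have e4 : u ^ (κ - 1) = u ^ κ / u := by rw [Real.rpow_sub_one hu0.ne']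
  have hp : 0 < u ^ κ := Real.rpow_pos_of_pos hu0 _
  have e5 : (u - C) ^ (κ + 1) / (u + C) = u ^ κ * ((1 - t) ^ (κ + 1) / (1 + t)) := by
    rw [e3, e1]
    have : 1 + t ≠ 0 := by linarith
    field_simp
  have b1 : 1 - (κ + 2) * t ≤ (1 - t) ^ (κ + 1) / (1 + t) := by
    rw [le_div_iff₀ (by linarith)]
    have h := one_add_mul_self_le_rpow_one_add (s := -t) (by linarith) (p := κ + 1) (by linarith)
    have : (1 : ℝ) + -t = 1 - t := by ring
    rw [this] at h
    nlinarith [mul_nonneg ht0 ht0]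
  rw [e5, e4]
  calc _ = u ^ κ * (1 - (κ + 2) * t) := by rw [ht]; ring
    _ ≤ _ := by gcongr

theorem tauber (g : ℕ → ℝ) (hg : ∀ n, 0 ≤ g n) (hg1 : 0 < g 1) (κ C : ℝ) (hκ : 1 ≤ κ)
    (H : ∀ u, 0 ≤ u → |u * partN g u - (κ + 1) * partT g u| ≤ C * partN g u) :
    ∃ A : ℝ, 0 < A ∧ ∃ D : ℝ, ∀ u, Real.log 2 ≤ u →
      |partN g u - A * u ^ κ| ≤ D * u ^ (κ - 1) := by
  have hNn : ∀ u, 0 ≤ partN g u := fun u => Finset.sum_nonneg fun _ _ => hg _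
  have hNmono : ∀ u v, u ≤ v → partN g u ≤ partN g v := by
    intro u v h
    apply Finset.sum_le_sum_of_subset_of_nonneg
    · intro m hm
      rw [mem_floor_exp] at *
      exact ⟨hm.1, hm.2.trans h⟩
    · exact fun _ _ _ => hg _
  wlog hC : 1 ≤ C generalizing C
  · exact this (max C 1) (fun u hu => (H u hu).trans
      (mul_le_mul_of_nonneg_right (le_max_left _ _) (hNn u))) (le_max_right _ _)
  have H1 : ∀ u, C < u → (u - C) * partN g u ≤ (κ + 1) * partT g u := by
    intro u hu
    have := (abs_le.1 (H u (by linarith))).2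
    linarith
  have H2 : ∀ u, 0 ≤ u → (κ + 1) * partT g u ≤ (u - (-C)) * partN g u := by
    intro u hu
    have := (abs_le.1 (H u (by linarith))).1
    linarith
  have hTpos : ∀ u, 0 < u → 0 < partT g u := by
    intro u hu
    apply Finset.sum_pos'
    · intro m hm
      rw [mem_floor_exp] at hm
      exact mul_nonneg (hg _) (by linarith [hm.2])
    · exact ⟨1, by rw [mem_floor_exp]; simp [hu.le], by simp; positivity⟩
  set P : ℝ → ℝ := fun u => partT g u * (u - C) ^ (-(κ + 1)) with hP
  set Q : ℝ → ℝ := fun u => partT g u * (u - (-C)) ^ (-(κ + 1)) with hQ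
  have hPanti : ∀ a b, C < a → a ≤ b → P b ≤ P a := fun a b h hab =>
    ratio_anti g (κ + 1) C H1 h hab
  have hQmono : ∀ a b, C < a → a ≤ b → Q a ≤ Q b := fun a b h hab =>
    ratio_mono g (κ + 1) (-C) (by linarith) hab (fun u hu => H2 u (by linarith))
  have hQP : ∀ a, C < a → Q a ≤ P a := by
    intro a ha
    apply mul_le_mul_of_nonneg_left _ (hTpos a (by linarith)).le
    exact Real.rpow_le_rpow_of_nonpos (by linarith) (by linarith) (by linarith)
  have hQP' : ∀ a b, C < a → C < b → Q a ≤ P b := by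
    intro a b ha hb
    rcases le_total a b with h | h
    · exact (hQmono a b ha h).trans (hQP b hb)
    · exact (hQP a ha).trans (hPanti b a hb h)
  have hne : (Q '' Set.Ioi C).Nonempty := ⟨_, C + 1, by simp, rfl⟩
  have hbd : BddAbove (Q '' Set.Ioi C) := by
    refine ⟨P (C + 1), ?_⟩
    rintro _ ⟨a, ha, rfl⟩
    exact hQP' a _ ha (by linarith)
  set A' := sSup (Q '' Set.Ioi C) with hA'
  have hA1 : ∀ u, C < u → Q u ≤ A' := fun u hu => le_csSup hbd ⟨u, hu, rfl⟩
  have hA2 : ∀ u, C < u → A' ≤ P u := fun u hu => csSup_le hne (by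
    rintro _ ⟨a, ha, rfl⟩
    exact hQP' a _ ha hu)
  have hA0 : 0 < A' := lt_of_lt_of_le (mul_pos (hTpos (C + 1) (by linarith))
    (Real.rpow_pos_of_pos (by linarith) _)) (hA1 (C + 1) (by linarith))
  have hT1 : ∀ u, C < u → partT g u ≤ A' * (u + C) ^ (κ + 1) := by
    intro u hu
    have h := hA1 u hu
    simp only [hQ, sub_neg_eq_add] at h
    rw [Real.rpow_neg (by linarith), ← div_eq_mul_inv,
      div_le_iff₀ (Real.rpow_pos_of_pos (by linarith) _)] at h
    exact h
  have hT2 : ∀ u, C < u → A' * (u - C) ^ (κ + 1) ≤ partT g u := by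
    intro u hu
    have h := hA2 u hu
    simp only [hP] at h
    rw [Real.rpow_neg (by linarith), ← div_eq_mul_inv,
      le_div_iff₀ (Real.rpow_pos_of_pos (by linarith) _)] at h
    exact h
  set A := (κ + 1) * A' with hA
  have hApos : 0 < A := by positivity
  set D1 := A * ((κ + 3) * C * Real.exp (κ + 3)) with hD1
  set D2 := A * ((κ + 2) * C) with hD2
  set D3 := (partN g (2 * C) + A * (2 * C) ^ κ) / (Real.log 2) ^ (κ - 1) with hD3
  have hl2 : 0 < Real.log 2 := Real.log_pos (by norm_num)
  have hD1n : 0 ≤ D1 := by positivity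
  have hD2n : 0 ≤ D2 := by positivity
  have hD3n : 0 ≤ D3 := by have := hNn (2 * C); positivity
  refine ⟨A, hApos, D1 + D2 + D3, fun u hu => ?_⟩
  have hu0 : 0 < u := by linarith
  have hw : 0 < u ^ (κ - 1) := Real.rpow_pos_of_pos hu0 _
  rcases le_total (2 * C) u with h | h
  · have hCu : C < u := by linarith
    have up : partN g u ≤ A * ((u + C) ^ (κ + 1) / (u - C)) := by
      rw [← mul_div_assoc, le_div_iff₀ (by linarith)]
      have := H1 u hCu
      have := hT1 u hCu
      nlinarith
    have lo : A * ((u - C) ^ (κ + 1) / (u + C)) ≤ partN g u := by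
      rw [← mul_div_assoc, div_le_iff₀ (by linarith)]
      have := H2 u hu0.le
      have := hT2 u hCu
      nlinarith
    have r1 := mul_le_mul_of_nonneg_left (rpow_upper κ C u hκ hC h) hApos.le
    have r2 := mul_le_mul_of_nonneg_left (rpow_lower κ C u hκ hC h) hApos.le
    have z1 := mul_nonneg hD1n hw.le
    have z2 := mul_nonneg hD2n hw.le
    have z3 := mul_nonneg hD3n hw.le
    have s1 : D1 * u ^ (κ - 1) = A * ((κ + 3) * C * Real.exp (κ + 3) * u ^ (κ - 1)) := by
      rw [hD1]; ring
    have s2 : D2 * u ^ (κ - 1) = A * ((κ + 2) * C * u ^ (κ - 1)) := by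
      rw [hD2]; ring
    rw [abs_le]
    constructor <;> linarith
  · have z1 := mul_nonneg hD1n hw.le
    have z2 := mul_nonneg hD2n hw.le
    have z3 : partN g (2 * C) + A * (2 * C) ^ κ ≤ D3 * u ^ (κ - 1) := by
      rw [hD3, div_mul_eq_mul_div, le_div_iff₀ (by positivity)]
      have := hNn (2 * C)
      gcongr
    have a1 := hNmono u _ h
    have a2 : u ^ κ ≤ (2 * C) ^ κ := Real.rpow_le_rpow hu0.le h (by linarith)
    have a3 : 0 ≤ u ^ κ := by positivity
    have a4 := hNn u
    rw [abs_le]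
    constructor <;> nlinarith

lemma summable_log_div_sq : Summable (fun n : ℕ => Real.log n / (n : ℝ) ^ 2) := by
  have h : Summable (fun n : ℕ => 2 * (n : ℝ) ^ (-(3 / 2) : ℝ)) :=
    (Real.summable_nat_rpow.2 (by norm_num)).mul_left 2
  refine Summable.of_nonneg_of_le (fun n => ?_) (fun n => ?_) h
  · exact div_nonneg (Real.log_natCast_nonneg n) (by positivity)
  · rcases Nat.eq_zero_or_pos n with rfl | hn
    · simp
    have hn' : (0 : ℝ) < n := by exact_mod_cast hn
    have h1 := Real.log_le_rpow_div hn'.le (ε := 1 / 2) (by norm_num)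
    have h2 : (n : ℝ) ^ (-(3 / 2) : ℝ) = (n : ℝ) ^ (1 / 2 : ℝ) / (n : ℝ) ^ 2 := by
      rw [← Real.rpow_natCast, ← Real.rpow_sub hn']; norm_num
    rw [h2, ← mul_div_assoc]
    gcongr
    linarith

/-- The constant `∑ log n / n^2`. -/
noncomputable def logSqConst : ℝ := ∑' n : ℕ, Real.log n / (n : ℝ) ^ 2

lemma logSqConst_nonneg : 0 ≤ logSqConst :=
  tsum_nonneg fun n => div_nonneg (Real.log_natCast_nonneg n) (by positivity)

lemma sum_log_div_sq_le (s : Finset ℕ) : ∑ p ∈ s, Real.log p / (p : ℝ) ^ 2 ≤ logSqConst :=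
  summable_log_div_sq.sum_le_tsum s
    fun n _ => div_nonneg (Real.log_natCast_nonneg n) (by positivity)

lemma log_eq_sum_primesLE {n N : ℕ} (hn : ∀ p, p.Prime → p ∣ n → p ≤ N) :
    Real.log n = ∑ p ∈ N.primesLE, (n.factorization p : ℝ) * Real.log p := by
  rw [Real.log_nat_eq_sum_factorization, Finsupp.sum]
  apply Finset.sum_subset
  · intro p hp
    rw [Nat.support_factorization, Nat.mem_primeFactors] at hp
    rw [Nat.mem_primesLE]
    exact ⟨hn p hp.1 hp.2.1, hp.1⟩
  · intro p _ hp
    rw [Finsupp.notMem_support_iff.1 hp]; simp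

lemma fact_val_upper {p K : ℕ} (hp : p.Prime) :
    ((K.factorial.factorization p : ℕ) : ℝ) ≤ K / p + 2 * (K / (p : ℝ) ^ 2) := by
  have := Fact.mk hp
  have h := sub_one_mul_padicValNat_factorial (p := p) K
  rw [← Nat.factorization_def _ hp] at h
  have h1 : (p - 1) * K.factorial.factorization p ≤ K := by omega
  have hp2 : (2 : ℝ) ≤ p := by exact_mod_cast hp.two_le
  have h2 : ((p : ℝ) - 1) * (K.factorial.factorization p : ℕ) ≤ K := by
    have : (((p - 1 : ℕ)) : ℝ) * (K.factorial.factorization p : ℕ) ≤ K := by exact_mod_cast h1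
    rwa [Nat.cast_sub hp.one_le, Nat.cast_one] at this
  have hK : (0 : ℝ) ≤ K := Nat.cast_nonneg K
  calc ((K.factorial.factorization p : ℕ) : ℝ) ≤ K / ((p : ℝ) - 1) := by
        rw [le_div_iff₀ (by linarith)]; linarith
    _ ≤ K * ((p + 2) / (p : ℝ) ^ 2) := by
        rw [div_eq_mul_inv]
        apply mul_le_mul_of_nonneg_left _ hK
        rw [inv_eq_one_div, div_le_div_iff₀ (by linarith) (by positivity)]
        nlinarith
    _ = _ := by field_simp

lemma fact_val_lower {p K : ℕ} (hp : p.Prime) :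
    (K : ℝ) / p - 1 ≤ ((K.factorial.factorization p : ℕ) : ℝ) := by
  have h : K / p ≤ K.factorial.factorization p := by
    rw [Nat.factorization_factorial hp (Nat.lt_succ_of_le (Nat.le_succ _))]
    calc K / p = K / p ^ 1 := by simp
      _ ≤ _ := Finset.single_le_sum (f := fun i => K / p ^ i) (fun _ _ => Nat.zero_le _) (by simp)
  have h2 : (K : ℝ) / p < (K / p : ℕ) + 1 := by
    have := Nat.lt_floor_add_one ((K : ℝ) / p)
    rwa [Nat.floor_div_natCast, Nat.floor_natCast] at this
  have : ((K / p : ℕ) : ℝ) ≤ (K.factorial.factorization p : ℕ) := by exact_mod_cast h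
  linarith

/-- Mertens' first theorem. -/
theorem mertens_first : ∃ C : ℝ, ∀ K : ℕ, 1 ≤ K →
    |(∑ p ∈ K.primesLE, Real.log p / p) - Real.log K| ≤ C := by
  refine ⟨1 + 2 * logSqConst + Real.log 4, fun K hK => ?_⟩
  have hK0 : (0 : ℝ) < K := by exact_mod_cast hK
  have hl : Real.log K.factorial
      = ∑ p ∈ K.primesLE, (K.factorial.factorization p : ℝ) * Real.log p :=
    log_eq_sum_primesLE fun p hp hd => (hp.dvd_factorial).1 hd
  have up : Real.log K.factorial ≤ K * (∑ p ∈ K.primesLE, Real.log p / p)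
      + K * (2 * logSqConst) := by
    calc _ ≤ ∑ p ∈ K.primesLE, (K / p + 2 * (K / (p : ℝ) ^ 2)) * Real.log p := by
          rw [hl]
          apply Finset.sum_le_sum
          intro p hp
          exact mul_le_mul_of_nonneg_right (fact_val_upper (Nat.mem_primesLE.1 hp).2)
            (Real.log_natCast_nonneg p)
      _ = K * (∑ p ∈ K.primesLE, Real.log p / p)
          + K * (2 * ∑ p ∈ K.primesLE, Real.log p / (p : ℝ) ^ 2) := by
          rw [Finset.mul_sum, Finset.mul_sum, Finset.mul_sum, ← Finset.sum_add_distrib]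
          exact Finset.sum_congr rfl fun p _ => by ring
      _ ≤ _ := by gcongr; exact sum_log_div_sq_le _
  have lo : K * (∑ p ∈ K.primesLE, Real.log p / p) - Real.log 4 * K
      ≤ Real.log K.factorial := by
    have hth := Chebyshev.theta_le_log4_mul_x (x := K) hK0.le
    rw [Chebyshev.theta_eq_sum_primesLE_log] at hth
    calc _ ≤ K * (∑ p ∈ K.primesLE, Real.log p / p) - ∑ p ∈ K.primesLE, Real.log p := by
          linarith
      _ = ∑ p ∈ K.primesLE, ((K : ℝ) / p - 1) * Real.log p := by
          rw [Finset.mul_sum, ← Finset.sum_sub_distrib]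
          exact Finset.sum_congr rfl fun p _ => by ring
      _ ≤ _ := by
          rw [hl]
          apply Finset.sum_le_sum
          intro p hp
          exact mul_le_mul_of_nonneg_right (fact_val_lower (Nat.mem_primesLE.1 hp).2)
            (Real.log_natCast_nonneg p)
  have hf0 : (0 : ℝ) < K.factorial := by exact_mod_cast K.factorial_pos
  have s1 : Real.log K.factorial ≤ K * Real.log K := by
    rw [← Real.log_pow]
    exact Real.log_le_log hf0 (by exact_mod_cast Nat.factorial_le_pow K)
  have s2 : K * Real.log K - K ≤ Real.log K.factorial := by
    have := Real.pow_div_factorial_le_exp K hK0.le K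
    have h2 := Real.log_le_log (by positivity) this
    rw [Real.log_exp, Real.log_div (by positivity) hf0.ne', Real.log_pow] at h2
    linarith
  have hc := logSqConst_nonneg
  have h4 : 0 < Real.log 4 := Real.log_pos (by norm_num)
  rw [abs_le]
  constructor
  · refine le_of_mul_le_mul_left ?_ hK0
    nlinarith
  · refine le_of_mul_le_mul_left ?_ hK0
    nlinarith

/-- The value of `d_r` at a `k`-th power of a prime. -/
noncomputable def cf (r : ℝ) (k : ℕ) : ℝ := Real.Gamma (k + r) / (Real.Gamma r * Nat.factorial k)

lemma cf_zero {r : ℝ} (hr : 1 ≤ r) : cf r 0 = 1 := by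
  have : Real.Gamma r ≠ 0 := (Real.Gamma_pos_of_pos (by linarith)).ne'
  simp [cf, this]

lemma cf_pos {r : ℝ} (hr : 1 ≤ r) (k : ℕ) : 0 < cf r k := by
  have h1 : 0 < Real.Gamma r := Real.Gamma_pos_of_pos (by linarith)
  have h2 : 0 < Real.Gamma (k + r) := Real.Gamma_pos_of_pos (by positivity)
  unfold cf; positivity

lemma cf_succ {r : ℝ} (hr : 1 ≤ r) (k : ℕ) : cf r (k + 1) = cf r k * ((k + r) / (k + 1)) := by
  have h1 : 0 < Real.Gamma r := Real.Gamma_pos_of_pos (by linarith)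
  have h3 : (k : ℝ) + r ≠ 0 := by positivity
  unfold cf
  have : ((k + 1 : ℕ) : ℝ) + r = (k + r) + 1 := by push_cast; ring
  rw [this, Real.Gamma_add_one h3, Nat.factorial_succ]
  push_cast
  field_simp

lemma cf_one {r : ℝ} (hr : 1 ≤ r) : cf r 1 = r := by
  have := cf_succ hr 0
  rw [cf_zero hr] at this
  simpa using this

lemma genDivisor_mul {r : ℝ} (hr : 1 ≤ r) {p m : ℕ} (hp : p.Prime) (hm : m ≠ 0) (hpm : ¬ p ∣ m)
    (k : ℕ) : genDivisor r (p ^ k * m) = cf r k * genDivisor r m := by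
  unfold genDivisor
  rw [Nat.factorization_mul (pow_ne_zero _ hp.ne_zero) hm, hp.factorization_pow,
    Finsupp.prod_add_index_of_disjoint, Finsupp.prod_single_index]
  · rfl
  · exact cf_zero hr
  · rw [Finset.disjoint_left]
    intro q hq hq'
    have := Finsupp.support_single_subset hq
    rw [Finset.mem_singleton] at this
    subst this
    rw [Nat.support_factorization, Nat.mem_primeFactors] at hq'
    exact hpm hq'.2.1

/-- The summand. -/
noncomputable def gg (r : ℝ) (n : ℕ) : ℝ := genDivisor r n ^ 2 / n

lemma gg_nonneg (r : ℝ) (n : ℕ) : 0 ≤ gg r n := by unfold gg; positivity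

lemma gg_one (r : ℝ) : gg r 1 = 1 := by simp [gg, genDivisor]

lemma gg_mul {r : ℝ} (hr : 1 ≤ r) {p m : ℕ} (hp : p.Prime) (hm : m ≠ 0) (hpm : ¬ p ∣ m)
    (k : ℕ) : gg r (p ^ k * m) = cf r k ^ 2 / (p : ℝ) ^ k * gg r m := by
  unfold gg
  rw [genDivisor_mul hr hp hm hpm]
  push_cast
  have : (m : ℝ) ≠ 0 := by exact_mod_cast hm
  have : (p : ℝ) ≠ 0 := by exact_mod_cast hp.ne_zero
  field_simp

/-- Coefficients of the error. -/
noncomputable def ec (r : ℝ) (k : ℕ) : ℝ := (k : ℝ) * cf r k ^ 2 + r ^ 2 * cf r (k - 1) ^ 2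

lemma ec_nonneg (r : ℝ) (k : ℕ) : 0 ≤ ec r k := by unfold ec; positivity

open Filter Topology in
lemma cf_summable {r : ℝ} (hr : 1 ≤ r) :
    Summable (fun k : ℕ => ((k : ℝ) + 1) * cf r k ^ 2 / 2 ^ k) := by
  apply summable_of_ratio_test_tendsto_lt_one (l := 1 / 2) (by norm_num)
  · filter_upwards with n
    have := cf_pos hr n
    positivity
  · have h1 : Tendsto (fun k : ℕ => (1 : ℝ) / ((k : ℝ) + 1)) atTop (𝓝 0) :=
      tendsto_one_div_add_atTop_nhds_zero_nat
    have h2 : Tendsto (fun k : ℕ => (1 + 1 / ((k : ℝ) + 1)) *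
        (1 + (r - 1) * (1 / ((k : ℝ) + 1))) ^ 2 * (1 / 2)) atTop
        (𝓝 ((1 + 0) * (1 + (r - 1) * 0) ^ 2 * (1 / 2))) :=
      ((h1.const_add 1).mul (((h1.const_mul (r - 1)).const_add 1).pow 2)).mul_const _
    have h3 : ((1 : ℝ) + 0) * (1 + (r - 1) * 0) ^ 2 * (1 / 2) = 1 / 2 := by norm_num
    rw [h3] at h2
    refine h2.congr fun k => ?_
    have hk := cf_pos hr k
    have hk1 := cf_pos hr (k + 1)
    rw [Real.norm_of_nonneg (by positivity), Real.norm_of_nonneg (by positivity), cf_succ hr]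
    push_cast
    field_simp
    ring

lemma ec_summable {r : ℝ} (hr : 1 ≤ r) : Summable (fun k : ℕ => ec r k / 2 ^ k) := by
  have h := cf_summable hr
  rw [← summable_nat_add_iff 1]
  have h1 := (summable_nat_add_iff 1).2 h
  refine Summable.of_nonneg_of_le (fun k => ?_) (fun k => ?_) (h1.add (h.mul_left (r ^ 2)))
  · exact div_nonneg (ec_nonneg _ _) (by positivity)
  · unfold ec
    simp only [Nat.add_sub_cancel]
    rw [add_div]
    apply add_le_add
    · gcongr
      push_cast; linarith
    · rw [mul_div_assoc]
      have a : cf r k ^ 2 ≤ ((k : ℝ) + 1) * cf r k ^ 2 :=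
        le_mul_of_one_le_left (by positivity) (by linarith [Nat.cast_nonneg (α := ℝ) k])
      have b : (2 : ℝ) ^ k ≤ 2 ^ (k + 1) := by gcongr <;> norm_num
      gcongr

/-- The constant in the error. -/
noncomputable def ecC (r : ℝ) : ℝ := ∑' k : ℕ, ec r k / 2 ^ k

lemma sum_ec_le {r : ℝ} (hr : 1 ≤ r) {p : ℕ} (hp : p.Prime) (N : ℕ) :
    ∑ k ∈ Finset.range N, (if 2 ≤ k then ec r k / (p : ℝ) ^ k else 0)
      ≤ 4 * ecC r / (p : ℝ) ^ 2 := by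
  have hp2 : (2 : ℝ) ≤ p := by exact_mod_cast hp.two_le
  calc _ ≤ ∑ k ∈ Finset.range N, 4 / (p : ℝ) ^ 2 * (ec r k / 2 ^ k) := by
        apply Finset.sum_le_sum
        intro k _
        have := ec_nonneg r k
        split_ifs with h
        · obtain ⟨j, rfl⟩ := Nat.exists_eq_add_of_le h
          rw [div_mul_div_comm, div_le_div_iff₀ (by positivity) (by positivity)]
          have : (2 : ℝ) ^ j ≤ (p : ℝ) ^ j := by gcongr
          have e1 : ec r (2 + j) * ((p : ℝ) ^ 2 * 2 ^ (2 + j))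
            = (4 * ec r (2 + j) * (p : ℝ) ^ 2) * 2 ^ j := by rw [pow_add]; ring
          have e2 : 4 * ec r (2 + j) * (p : ℝ) ^ (2 + j)
            = (4 * ec r (2 + j) * (p : ℝ) ^ 2) * (p : ℝ) ^ j := by rw [pow_add]; ring
          rw [e1, e2]
          gcongr
        · positivity
    _ = 4 / (p : ℝ) ^ 2 * ∑ k ∈ Finset.range N, ec r k / 2 ^ k := by rw [Finset.mul_sum]
    _ ≤ 4 / (p : ℝ) ^ 2 * ecC r := by
        gcongr
        exact (ec_summable hr).sum_le_tsum _
          fun k _ => div_nonneg (ec_nonneg _ _) (by positivity)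
    _ = _ := by ring

lemma ecC_nonneg (r : ℝ) : 0 ≤ ecC r :=
  tsum_nonneg fun k => div_nonneg (ec_nonneg _ _) (by positivity)

/-- The partial sum. -/
noncomputable def MM (r : ℝ) (N : ℕ) : ℝ := ∑ m ∈ Finset.Icc 1 N, gg r m

lemma MM_nonneg (r : ℝ) (N : ℕ) : 0 ≤ MM r N := Finset.sum_nonneg fun _ _ => gg_nonneg _ _

lemma sum_ordCompl_le (r : ℝ) (b : ℕ → ℝ) (hb : ∀ k, 0 ≤ b k) (p : ℕ) (N : ℕ) :
    ∑ n ∈ Finset.Icc 1 N, b (n.factorization p) * gg r (n / p ^ n.factorization p)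
      ≤ (∑ k ∈ Finset.range (N + 1), b k) * MM r N := by
  unfold MM
  rw [Finset.sum_mul_sum, ← Finset.sum_product']
  let φ : ℕ → ℕ × ℕ := fun n => (n.factorization p, n / p ^ n.factorization p)
  have hinj : Set.InjOn φ (Finset.Icc 1 N : Finset ℕ) := by
    intro a _ c _ h
    simp only [φ, Prod.mk.injEq] at h
    rw [← Nat.ordProj_mul_ordCompl_eq_self a p, ← Nat.ordProj_mul_ordCompl_eq_self c p, h.2, h.1]
  rw [← Finset.sum_image (f := fun x : ℕ × ℕ => b x.1 * gg r x.2) hinj]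
  apply Finset.sum_le_sum_of_subset_of_nonneg
  · intro x hx
    obtain ⟨n, hn, rfl⟩ := Finset.mem_image.1 hx
    rw [Finset.mem_Icc] at hn
    have h1 := Nat.factorization_lt (n := n) p (by omega)
    have h2 : 0 < n / p ^ n.factorization p := Nat.ordCompl_pos p (by omega)
    have h3 : n / p ^ n.factorization p ≤ n := Nat.div_le_self _ _
    simp only [φ, Finset.mem_product, Finset.mem_range, Finset.mem_Icc]
    omega
  · intro x _ _
    exact mul_nonneg (hb _) (gg_nonneg _ _)

lemma sum_multiples (r : ℝ) {p : ℕ} (hp : p.Prime) (N : ℕ) :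
    MM r (N / p) = ∑ n ∈ Finset.Icc 1 N, if p ∣ n then gg r (n / p) else 0 := by
  unfold MM
  rw [← Finset.sum_filter]
  refine Finset.sum_bij' (fun m _ => p * m) (fun n _ => n / p) ?_ ?_ ?_ ?_ ?_
  · intro m hm
    simp only [Finset.mem_filter, Finset.mem_Icc] at *
    refine ⟨⟨Nat.mul_pos hp.pos hm.1, ?_⟩, dvd_mul_right _ _⟩
    rw [mul_comm]
    exact (Nat.le_div_iff_mul_le hp.pos).1 hm.2
  · intro n hn
    simp only [Finset.mem_filter, Finset.mem_Icc] at *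
    exact ⟨Nat.div_pos (Nat.le_of_dvd (by omega) hn.2) hp.pos, Nat.div_le_div_right hn.1.2⟩
  · intro m _
    exact Nat.mul_div_cancel_left m hp.pos
  · intro n hn
    simp only [Finset.mem_filter] at hn
    exact Nat.mul_div_cancel' hn.2
  · intro m _
    rw [Nat.mul_div_cancel_left m hp.pos]

lemma pointwise {r : ℝ} (hr : 1 ≤ r) {p n : ℕ} (hp : p.Prime) (hn : n ≠ 0) :
    |gg r n * n.factorization p - r ^ 2 / p * (if p ∣ n then gg r (n / p) else 0)| ≤
      (if 2 ≤ n.factorization p then ec r (n.factorization p) / (p : ℝ) ^ n.factorization p else 0)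
        * gg r (n / p ^ n.factorization p) := by
  set k := n.factorization p with hk
  set m := n / p ^ k with hm
  have hnm : p ^ k * m = n := Nat.ordProj_mul_ordCompl_eq_self n p
  have hm0 : m ≠ 0 := (Nat.ordCompl_pos p hn).ne'
  have hpm : ¬ p ∣ m := Nat.not_dvd_ordCompl hp hn
  have hgm := gg_nonneg r m
  have hp0 : (p : ℝ) ≠ 0 := by exact_mod_cast hp.ne_zero
  have hp1 : (0 : ℝ) < p := by exact_mod_cast hp.pos
  rw [← hnm, gg_mul hr hp hm0 hpm]
  rcases Nat.eq_zero_or_pos k with h0 | hpos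
  · have : ¬ p ∣ p ^ k * m := by rw [h0]; simpa using hpm
    rw [if_neg this, if_neg (by omega), h0]; simp
  · obtain ⟨j, hj⟩ : ∃ j, k = j + 1 := ⟨k - 1, by omega⟩
    have hd : p ∣ p ^ k * m := (dvd_pow_self p hpos.ne').mul_right m
    have hq : p ^ k * m / p = p ^ j * m := by
      rw [hj, pow_succ', mul_assoc, Nat.mul_div_cancel_left _ hp.pos]
    rw [if_pos hd, hq, gg_mul hr hp hm0 hpm]
    have key : cf r k ^ 2 / (p : ℝ) ^ k * gg r m * k
        - r ^ 2 / p * (cf r j ^ 2 / (p : ℝ) ^ j * gg r m)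
        = (k * cf r k ^ 2 - r ^ 2 * cf r j ^ 2) / (p : ℝ) ^ k * gg r m := by
      rw [hj, pow_succ]; field_simp; ring
    rw [key]
    split_ifs with h2
    · rw [abs_mul, abs_of_nonneg hgm, abs_div, abs_of_pos (a := (p : ℝ) ^ k) (by positivity)]
      gcongr
      unfold ec
      have : k - 1 = j := by omega
      rw [this, abs_le]
      constructor <;> nlinarith [sq_nonneg (cf r k), sq_nonneg (r * cf r j),
        mul_nonneg (Nat.cast_nonneg (α := ℝ) k) (sq_nonneg (cf r k))]
    · have h1 : k = 1 := by omega
      have h3 : j = 0 := by omega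
      rw [h1, h3, cf_one hr, cf_zero hr]; simp

lemma prime_bound {r : ℝ} (hr : 1 ≤ r) {p : ℕ} (hp : p.Prime) (N : ℕ) :
    |(∑ n ∈ Finset.Icc 1 N, gg r n * n.factorization p) - r ^ 2 / p * MM r (N / p)| ≤
      4 * ecC r / (p : ℝ) ^ 2 * MM r N := by
  rw [sum_multiples r hp, Finset.mul_sum, ← Finset.sum_sub_distrib]
  refine (Finset.abs_sum_le_sum_abs _ _).trans ?_
  refine (Finset.sum_le_sum fun n hn => pointwise hr hp
    (by rw [Finset.mem_Icc] at hn; omega)).trans ?_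
  refine (sum_ordCompl_le r (fun k => if 2 ≤ k then ec r k / (p : ℝ) ^ k else 0) ?_ p N).trans ?_
  · intro k
    have := ec_nonneg r k
    split_ifs <;> positivity
  · exact mul_le_mul_of_nonneg_right (sum_ec_le hr hp _) (MM_nonneg _ _)

lemma key_bound {r : ℝ} (hr : 1 ≤ r) (N : ℕ) :
    |(∑ n ∈ Finset.Icc 1 N, gg r n * Real.log n)
      - r ^ 2 * ∑ m ∈ Finset.Icc 1 N, gg r m * ∑ p ∈ (N / m).primesLE, Real.log p / p| ≤
      4 * ecC r * logSqConst * MM r N := by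
  have e1 : ∑ n ∈ Finset.Icc 1 N, gg r n * Real.log n
      = ∑ p ∈ N.primesLE, Real.log p * ∑ n ∈ Finset.Icc 1 N, gg r n * n.factorization p := by
    simp_rw [Finset.mul_sum]
    rw [Finset.sum_comm]
    refine Finset.sum_congr rfl fun n hn => ?_
    rw [Finset.mem_Icc] at hn
    rw [log_eq_sum_primesLE (n := n) (N := N)
      (fun p _ hd => (Nat.le_of_dvd (by omega) hd).trans hn.2), Finset.mul_sum]
    exact Finset.sum_congr rfl fun p _ => by ring
  have e2 : r ^ 2 * ∑ m ∈ Finset.Icc 1 N, gg r m * ∑ p ∈ (N / m).primesLE, Real.log p / p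
      = ∑ p ∈ N.primesLE, Real.log p * (r ^ 2 / p * MM r (N / p)) := by
    unfold MM
    simp_rw [Finset.mul_sum]
    rw [Finset.sum_comm' (t' := N.primesLE) (s' := fun p => Finset.Icc 1 (N / p))]
    · exact Finset.sum_congr rfl fun p _ => Finset.sum_congr rfl fun m _ => by ring
    · intro m p
      simp only [Finset.mem_Icc, Nat.mem_primesLE]
      constructor
      · rintro ⟨⟨h1, h2⟩, h3, h4⟩
        refine ⟨⟨h1, ?_⟩, h3.trans (Nat.div_le_self _ _), h4⟩
        rw [Nat.le_div_iff_mul_le h4.pos, mul_comm]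
        exact (Nat.le_div_iff_mul_le h1).1 h3
      · rintro ⟨⟨h1, h2⟩, h3, h4⟩
        refine ⟨⟨h1, h2.trans (Nat.div_le_self _ _)⟩, ?_, h4⟩
        rw [Nat.le_div_iff_mul_le h1, mul_comm]
        exact (Nat.le_div_iff_mul_le h4.pos).1 h2
  rw [e1, e2, ← Finset.sum_sub_distrib]
  refine (Finset.abs_sum_le_sum_abs _ _).trans ?_
  calc _ ≤ ∑ p ∈ N.primesLE, (4 * ecC r * MM r N) * (Real.log p / (p : ℝ) ^ 2) := by
        apply Finset.sum_le_sum
        intro p hp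
        rw [← mul_sub, abs_mul, abs_of_nonneg (Real.log_natCast_nonneg p)]
        have := mul_le_mul_of_nonneg_left (prime_bound hr (Nat.mem_primesLE.1 hp).2 N)
          (Real.log_natCast_nonneg p)
        refine this.trans (le_of_eq ?_)
        ring
    _ = (4 * ecC r * MM r N) * ∑ p ∈ N.primesLE, Real.log p / (p : ℝ) ^ 2 := by
        rw [Finset.mul_sum]
    _ ≤ (4 * ecC r * MM r N) * logSqConst := by
        have := ecC_nonneg r
        have := MM_nonneg r N
        gcongr
        exact sum_log_div_sq_le _
    _ = _ := by ring

lemma log_floor_near {y : ℝ} (hy : 1 ≤ y) : |Real.log ⌊y⌋₊ - Real.log y| ≤ Real.log 2 := by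
  have h1 : 1 ≤ ⌊y⌋₊ := (Nat.one_le_floor_iff _).2 hy
  have h1' : (1 : ℝ) ≤ ⌊y⌋₊ := by exact_mod_cast h1
  have h2 : (⌊y⌋₊ : ℝ) ≤ y := Nat.floor_le (by linarith)
  have h3 : y < ⌊y⌋₊ + 1 := Nat.lt_floor_add_one y
  have h4 := Real.log_le_log (by linarith) h2
  have h5 : Real.log y ≤ Real.log (2 * ⌊y⌋₊) := Real.log_le_log (by linarith) (by linarith)
  rw [Real.log_mul (by norm_num) (by linarith)] at h5
  rw [abs_le]
  constructor
  · linarith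
  · linarith [Real.log_pos (x := 2) (by norm_num)]

lemma main_hyp {r : ℝ} (hr : 1 ≤ r) : ∃ C : ℝ, ∀ u, 0 ≤ u →
    |u * partN (gg r) u - (r ^ 2 + 1) * partT (gg r) u| ≤ C * partN (gg r) u := by
  obtain ⟨C0, hC0⟩ := mertens_first
  refine ⟨4 * ecC r * logSqConst + r ^ 2 * (C0 + Real.log 2), fun u hu => ?_⟩
  set N := ⌊Real.exp u⌋₊ with hN
  have hM : partN (gg r) u = MM r N := rfl
  have hT : partT (gg r) u = ∑ m ∈ Finset.Icc 1 N, gg r m * (u - Real.log m) := rfl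
  have e1 : u * partN (gg r) u - partT (gg r) u
      = ∑ n ∈ Finset.Icc 1 N, gg r n * Real.log n := by
    rw [hT, partN, Finset.mul_sum, ← Finset.sum_sub_distrib]
    exact Finset.sum_congr rfl fun n _ => by ring
  have h2 : |(∑ m ∈ Finset.Icc 1 N, gg r m * ∑ p ∈ (N / m).primesLE, Real.log p / p)
      - partT (gg r) u| ≤ (C0 + Real.log 2) * MM r N := by
    rw [hT, ← Finset.sum_sub_distrib, MM, Finset.mul_sum]
    refine (Finset.abs_sum_le_sum_abs _ _).trans (Finset.sum_le_sum fun m hm => ?_)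
    rw [← mul_sub, abs_mul, abs_of_nonneg (gg_nonneg r m), mul_comm]
    refine mul_le_mul_of_nonneg_right ?_ (gg_nonneg r m)
    have hm' := mem_floor_exp.1 hm
    have hm0 : (0 : ℝ) < m := by exact_mod_cast hm'.1
    have hle : (m : ℝ) ≤ Real.exp u := (Real.log_le_iff_le_exp hm0).1 hm'.2
    have hy : 1 ≤ Real.exp u / m := by rw [le_div_iff₀ hm0]; linarith
    have hfl : ⌊Real.exp u / m⌋₊ = N / m := Nat.floor_div_natCast _ _
    have a1 := log_floor_near hy
    rw [hfl, Real.log_div (Real.exp_pos u).ne' hm0.ne', Real.log_exp] at a1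
    have a2 := hC0 (N / m) (by rw [← hfl]; exact (Nat.one_le_floor_iff _).2 hy)
    exact (abs_sub_le _ (Real.log ((N / m : ℕ) : ℝ)) _).trans (add_le_add a2 a1)
  have h1 := key_bound hr N
  rw [← e1] at h1
  rw [hM] at *
  have h3 := mul_le_mul_of_nonneg_left h2 (sq_nonneg r)
  rw [← abs_of_nonneg (sq_nonneg r), ← abs_mul, abs_of_nonneg (sq_nonneg r)] at h3
  rw [abs_le] at *
  constructor <;> nlinarith [h1.1, h1.2, h3.1, h3.2]

theorem sum_genDivisor_sq_div_asymptotic (r : ℝ) (hr : 1 ≤ r) :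
    ∃ A : ℝ, 0 < A ∧ ∃ C : ℝ, ∀ x : ℝ, 2 ≤ x →
      |(∑ k ∈ Finset.Icc 1 ⌊x⌋₊, genDivisor r k ^ 2 / k) -
          A * Real.log x ^ (r ^ 2)| ≤ C * Real.log x ^ (r ^ 2 - 1) := by
  obtain ⟨C, hC⟩ := main_hyp hr
  obtain ⟨A, hA, D, hD⟩ := tauber (gg r) (gg_nonneg r) (by rw [gg_one]; norm_num) (r ^ 2) C
    (by nlinarith) hC
  refine ⟨A, hA, D, fun x hx => ?_⟩
  have h := hD (Real.log x) (Real.log_le_log (by norm_num) hx)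
  rw [partN, Real.exp_log (by linarith)] at h
  exact h
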